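/- Let X be a type with a total cyclic order, x₀ ∈ X, let f be an order-preserving bijection of X, and let y ∈ X with y ≠ x₀ and f y ≠ x₀. Then f has a unique lift F with F (0, x₀) = (0, f x₀), and this lift satisfies F (0, y) = (n, f y), where n = 1 if sbtw x₀ (f y) (f x₀) and n = 0 otherwise. (Lemma 2.23 of the paper, 'lemtechniqueordre1': n = max(0, −o(x₀, f(x₀), f(y))).) -/

import Mathlib

open scoped Classical

/-- The relation `x ≺ y` on `X` relative to a base point `x₀`:
`x ≺ y` iff (`x = x₀` and `y ≠ x₀`) or `sbtw x₀ x y`. -/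
def Prec {X : Type*} [CircularOrder X] (x₀ x y : X) : Prop :=
  (x = x₀ ∧ y ≠ x₀) ∨ sbtw x₀ x y

/-- The strict order `<ₓ₀` on `ℤ × X`. -/
def LtZX {X : Type*} [CircularOrder X] (x₀ : X) (a b : ℤ × X) : Prop :=
  a.1 < b.1 ∨ (a.1 = b.1 ∧ Prec x₀ a.2 b.2)

/-- A map of `ℤ × X` projects to a map `f` of `X`. -/
def Projects {X : Type*} (F : ℤ × X → ℤ × X) (f : X → X) : Prop :=
  Prod.snd ∘ F = f ∘ Prod.snd

/-- A map of `ℤ × X` is increasing for the order `<ₓ₀`. -/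
def IncreasingZX {X : Type*} [CircularOrder X] (x₀ : X) (F : ℤ × X → ℤ × X) : Prop :=
  ∀ a b : ℤ × X, LtZX x₀ a b → LtZX x₀ (F a) (F b)

/-- A lift of an order-preserving bijection `f` of `X`: a bijection of `ℤ × X` that
projects to `f` and is increasing for `<ₓ₀`. -/
def IsLift {X : Type*} [CircularOrder X] (x₀ : X) (f : X → X) (F : ℤ × X → ℤ × X) : Prop :=
  Function.Bijective F ∧ Projects F f ∧ IncreasingZX x₀ F

section Prec

variable {X : Type*} [CircularOrder X] {p a b c : X}

theorem SBtw.sbtw.left_ne (h : sbtw a b c) : a ≠ b := by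
  rintro rfl; exact sbtw_irrefl_left h

theorem sbtw_or_sbtw_of_ne (hab : a ≠ b) (hbc : b ≠ c) (hca : c ≠ a) :
    sbtw a b c ∨ sbtw c b a := by
  by_contra! h
  rw [← btw_iff_not_sbtw, ← btw_iff_not_sbtw] at h
  rcases h.2.antisymm h.1 with h | h | h <;> contradiction

theorem prec_irrefl : ¬ Prec p a a := by
  rintro (⟨h, h'⟩ | h)
  · exact h' h
  · exact sbtw_irrefl_right h

theorem Prec.right_ne (h : Prec p a b) : b ≠ p := by
  rcases h with ⟨-, h⟩ | h
  · exact h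
  · exact h.cyclic_right.left_ne

theorem Prec.sbtw_of_ne (h : Prec p a b) (ha : a ≠ p) : sbtw p a b :=
  h.resolve_left fun h' => ha h'.1

theorem Prec.trans (hab : Prec p a b) (hbc : Prec p b c) : Prec p a c := by
  have hb := hbc.sbtw_of_ne hab.right_ne
  rcases hab with ⟨h, -⟩ | h
  · exact Or.inl ⟨h, hbc.right_ne⟩
  · exact Or.inr (h.trans_right hb)

theorem prec_trichotomy (p a b : X) : Prec p a b ∨ a = b ∨ Prec p b a := by
  by_cases hab : a = b
  · exact Or.inr (Or.inl hab)
  by_cases ha : a = p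
  · exact Or.inl (Or.inl ⟨ha, fun hb => hab (ha.trans hb.symm)⟩)
  by_cases hb : b = p
  · exact Or.inr (Or.inr (Or.inl ⟨hb, ha⟩))
  rcases sbtw_or_sbtw_of_ne (Ne.symm ha) hab hb with h | h
  · exact Or.inl (Or.inr h)
  · exact Or.inr (Or.inr (Or.inr h.cyclic_left.cyclic_left))

theorem Prec.sbtw_of_prec (hab : Prec p a b) (hbc : Prec p b c) : sbtw a b c := by
  have hb := hbc.sbtw_of_ne hab.right_ne
  rcases hab with ⟨rfl, -⟩ | h
  · exact hb
  · exact (hb.cyclic_right.trans_left h).cyclic_left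

theorem SBtw.sbtw.prec_cases (p : X) (h : sbtw a b c) :
    (Prec p a b ∧ Prec p b c) ∨ (Prec p b c ∧ Prec p c a) ∨ (Prec p c a ∧ Prec p a b) := by
  have hab := h.left_ne
  have hbc := h.cyclic_left.left_ne
  have hca := h.cyclic_right.left_ne
  have h₁ : ¬ (Prec p c b ∧ Prec p b a) := fun h' => h.not_sbtw (h'.1.sbtw_of_prec h'.2)
  have h₂ : ¬ (Prec p b a ∧ Prec p a c) := fun h' => h.cyclic_right.not_sbtw (h'.1.sbtw_of_prec h'.2)
  have h₃ : ¬ (Prec p a c ∧ Prec p c b) := fun h' => h.cyclic_left.not_sbtw (h'.1.sbtw_of_prec h'.2)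
  have := prec_trichotomy p a b
  have := prec_trichotomy p b c
  have := prec_trichotomy p c a
  tauto

end Prec

/-- A strictly monotone surjection of `ℤ` is a translation. -/
theorem StrictMono.int_eq_add_of_surjective {g : ℤ → ℤ} (hg : StrictMono g)
    (hs : Function.Surjective g) (n : ℤ) : g n = n + g 0 := by
  have hsucc : ∀ m, g (m + 1) = g m + 1 := by
    intro m
    obtain ⟨k, hk⟩ := hs (g m + 1)
    have h₁ : m < k := hg.lt_iff_lt.1 (by omega)
    have h₂ : g (m + 1) ≤ g k := hg.monotone (by omega)
    have h₃ : g m < g (m + 1) := hg (by omega)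
    omega
  induction n with
  | zero => simp
  | succ n ih => rw [hsucc, ih]; ring
  | pred n ih =>
    have := hsucc (-n - 1)
    rw [sub_add_cancel, ih] at this
    omega

section Lift

variable {X : Type*} [CircularOrder X] {x₀ : X} {f : X → X}

theorem IsLift.snd_apply {F : ℤ × X → ℤ × X} (hF : IsLift x₀ f F) (a : ℤ × X) :
    (F a).2 = f a.2 :=
  congrFun hF.2.1 a

theorem IsLift.fst_apply {F : ℤ × X → ℤ × X} (hF : IsLift x₀ f F)
    (hf : Function.Injective f) (n : ℤ) (x : X) : (F (n, x)).1 = n + (F (0, x)).1 := by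
  refine StrictMono.int_eq_add_of_surjective (g := fun n => (F (n, x)).1) ?_ ?_ n
  · intro m n hmn
    rcases hF.2.2 (m, x) (n, x) (Or.inl hmn) with h | ⟨-, h⟩
    · exact h
    · rw [hF.snd_apply, hF.snd_apply] at h
      exact absurd h prec_irrefl
  · intro k
    obtain ⟨⟨n, z⟩, hz⟩ := hF.1.2 (k, f x)
    have hzx : z = x := hf (by rw [← hF.snd_apply (n, z), hz])
    subst hzx
    exact ⟨n, by simp [hz]⟩

/-- The lift of `f` sending `(0, x₀)` to `(0, f x₀)`. -/
noncomputable def baseLift (x₀ : X) (f : X → X) (a : ℤ × X) : ℤ × X :=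
  (a.1 + if Prec x₀ (f a.2) (f x₀) then 1 else 0, f a.2)

theorem baseLift_base (x₀ : X) (f : X → X) : baseLift x₀ f (0, x₀) = (0, f x₀) := by
  simp [baseLift, prec_irrefl]

theorem IsLift.eq_baseLift {F : ℤ × X → ℤ × X} (hF : IsLift x₀ f F)
    (hf : Function.Injective f) (h₀ : F (0, x₀) = (0, f x₀)) : F = baseLift x₀ f := by
  funext ⟨n, x⟩
  refine Prod.ext ?_ (hF.snd_apply _)
  rw [hF.fst_apply hf]
  change _ = n + _
  congr 1
  by_cases hx : x = x₀
  · subst hx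
    simp [h₀, prec_irrefl]
  have hlow := hF.2.2 (0, x₀) (0, x) (Or.inr ⟨rfl, Or.inl ⟨rfl, hx⟩⟩)
  have hupp := hF.2.2 (0, x) (1, x₀) (Or.inl one_pos)
  have h₁ : (F (1, x₀)).1 = 1 := by rw [hF.fst_apply hf, h₀]; rfl
  simp only [LtZX, hF.snd_apply, h₀, h₁] at hlow hupp
  have hasymm : ¬ (Prec x₀ (f x) (f x₀) ∧ Prec x₀ (f x₀) (f x)) :=
    fun h => prec_irrefl (h.1.trans h.2)
  split_ifs with h
  · have : ¬ Prec x₀ (f x₀) (f x) := fun h' => hasymm ⟨h, h'⟩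
    simp only [this, and_false, or_false] at hlow
    omega
  · simp only [h, and_false, or_false] at hupp
    omega

theorem baseLift_bijective (hf : Function.Bijective f) :
    Function.Bijective (baseLift x₀ f) := by
  constructor
  · rintro ⟨m, x⟩ ⟨n, z⟩ h
    obtain rfl : x = z := hf.1 (congrArg Prod.snd h)
    simpa [baseLift] using h
  · rintro ⟨k, w⟩
    obtain ⟨x, rfl⟩ := hf.2 w
    exact ⟨(k - if Prec x₀ (f x) (f x₀) then 1 else 0, x), by simp [baseLift]⟩

theorem baseLift_increasing (hf : Function.Injective f)
    (hord : ∀ a b c : X, sbtw a b c → sbtw (f a) (f b) (f c)) :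
    IncreasingZX x₀ (baseLift x₀ f) := by
  rintro ⟨m, x⟩ ⟨n, z⟩ h
  have hirr : ¬ Prec x₀ (f x₀) (f x₀) := prec_irrefl
  have hztri := prec_trichotomy x₀ (f z) (f x₀)
  have hxasymm : ¬ (Prec x₀ (f x) (f x₀) ∧ Prec x₀ (f x₀) (f x)) :=
    fun h => prec_irrefl (h.1.trans h.2)
  simp only [LtZX, baseLift] at h ⊢
  rcases h with h | ⟨rfl, ⟨rfl, hz⟩ | h⟩
  · have htrans : Prec x₀ (f x) (f x₀) → Prec x₀ (f x₀) (f z) → Prec x₀ (f x) (f z) := Prec.trans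
    split_ifs with h₁ h₂ h₂
    · left; omega
    · have hxz : Prec x₀ (f x) (f z) := by
        rcases hztri with h' | h' | h'
        · contradiction
        · rwa [h']
        · exact htrans h₁ h'
      simp only [hxz, and_true]; omega
    · left; omega
    · left; omega
  · have hfz : f z ≠ f x := hf.ne hz
    split_ifs
    · left; omega
    · right; tauto
  · have hcases := (hord _ _ _ h).prec_cases x₀
    split_ifs
    · right; tauto
    · tauto
    · left; omega
    · right; tauto

theorem isLift_baseLift (hf : Function.Bijective f)
    (hord : ∀ a b c : X, sbtw a b c → sbtw (f a) (f b) (f c)) :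
    IsLift x₀ f (baseLift x₀ f) :=
  ⟨baseLift_bijective hf, rfl, baseLift_increasing hf.1 hord⟩

end Lift

/-- Lemma 2.23 of the paper (`lemtechniqueordre1`): if `y ≠ x₀` and `f y ≠ x₀`, then `f`
has a unique lift `F` with `F (0, x₀) = (0, f x₀)`, and this lift satisfies
`F (0, y) = (n, f y)` with `n = 1` if `sbtw x₀ (f y) (f x₀)` and `n = 0` otherwise. -/
theorem lift_value_at_y {X : Type*} [CircularOrder X] (x₀ : X)
    (f : X → X) (hbij : Function.Bijective f)
    (hord : ∀ a b c : X, sbtw a b c → sbtw (f a) (f b) (f c))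
    (y : X) (hy : y ≠ x₀) (hfy : f y ≠ x₀) :
    (∃! F : ℤ × X → ℤ × X, IsLift x₀ f F ∧ F (0, x₀) = (0, f x₀)) ∧
    ∀ F : ℤ × X → ℤ × X, IsLift x₀ f F → F (0, x₀) = (0, f x₀) →
      F (0, y) = (if sbtw x₀ (f y) (f x₀) then (1 : ℤ) else 0, f y) := by
  refine ⟨⟨baseLift x₀ f, ⟨isLift_baseLift hbij hord, baseLift_base x₀ f⟩,
    fun F hF => hF.1.eq_baseLift hbij.1 hF.2⟩, fun F hF h₀ => ?_⟩
  have hprec : Prec x₀ (f y) (f x₀) ↔ sbtw x₀ (f y) (f x₀) :=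
    ⟨fun h => h.sbtw_of_ne hfy, Or.inr⟩
  simp [hF.eq_baseLift hbij.1 h₀, baseLift, hprec]
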